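/- arXiv:1009.0035 — 2 statements merged into one kernel-verified Lean document; each statement's English description precedes it below -/
import Mathlib

section
/- For every a ∈ C ∪ {∞} and every i = 0, 1, …, 2n+1, the flag F_•(a) satisfies ⟨F_i(a), F_{2n+1−i}(a)⟩ = {0}; that is, F_{2n+1−i}(a) is contained in the orthogonal complement of F_i(a) with respect to the form ⟨·,·⟩. -/
open Polynomial OnePoint

namespace OG

/-! ### Tableaux, diagrams, jeu de taquin / tableau switching -/

/-- A cell `(row, column)` (0-indexed). -/
abbrev Cell := ℕ × ℕ

/-- A filling: a finite set of (cell, entry) pairs. -/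
abbrev Filling := Finset (Cell × ℕ)

def cellsOf (f : Filling) : Finset Cell := f.image Prod.fst

def entriesOf (f : Filling) : Finset ℕ := f.image Prod.snd

/-- A (perforated/partial) standard filling: at most one entry per cell, all entries
distinct, and entries strictly increase along rows and down columns. -/
def IsPartialTableau (f : Filling) : Prop :=
  (∀ p ∈ f, ∀ q ∈ f, p.1 = q.1 → p = q) ∧
  (∀ p ∈ f, ∀ q ∈ f, p.2 = q.2 → p = q) ∧
  (∀ p ∈ f, ∀ q ∈ f, p.1.1 = q.1.1 → p.1.2 < q.1.2 → p.2 < q.2) ∧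
  (∀ p ∈ f, ∀ q ∈ f, p.1.2 = q.1.2 → p.1.1 < q.1.1 → p.2 < q.2)

/-- A standard tableau on the diagram `D` with entry set `E`. -/
def IsTableauOn (f : Filling) (D : Finset Cell) (E : Finset ℕ) : Prop :=
  IsPartialTableau f ∧ cellsOf f = D ∧ entriesOf f = E

/-- One elementary switch of the tableau switching (jeu de taquin) algorithm:
an entry `u` of the inner (sliding) family `p.2` at cell `c` is interchanged with an
entry `t` of the outer family `p.1` lying immediately east or south of `c`, provided
both families remain partial standard tableaux. -/
def SwitchStep (p q : Filling × Filling) : Prop :=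
  ∃ c u d t, (c, u) ∈ p.2 ∧ (d, t) ∈ p.1 ∧
    (d = (c.1, c.2 + 1) ∨ d = (c.1 + 1, c.2)) ∧
    q.1 = insert (c, t) (p.1.erase (d, t)) ∧
    q.2 = insert (d, u) (p.2.erase (c, u)) ∧
    IsPartialTableau q.1 ∧ IsPartialTableau q.2

/-- `Switched T U A B`: applying the tableau switching algorithm to the outer tableau `T`
and the inner tableau `U` terminates with `A` (the rectification of `T`) inside and
`B` (the new outer tableau) outside. -/
def Switched (T U A B : Filling) : Prop :=
  Relation.ReflTransGen SwitchStep (T, U) (A, B) ∧ ∀ q, ¬ SwitchStep (A, B) q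

/-- `R` is the jeu de taquin rectification of the skew tableau `T` whose inner
(empty) region is the diagram `Din`. -/
def RectifiesTo (T : Filling) (Din : Finset Cell) (R : Filling) : Prop :=
  ∃ U B, IsTableauOn U Din (Finset.Icc 1 Din.card) ∧ Switched T U R B

/-- Dual equivalence of two skew tableaux with common inner diagram `Din`:
switching with any standard tableau `U` of shape `Din` produces the same outer
tableau `Û`. -/
def DualEquiv (Din : Finset Cell) (T T' : Filling) : Prop :=
  ∀ U A A' B B', IsTableauOn U Din (Finset.Icc 1 Din.card) →
    Switched T U A B → Switched T' U A' B' → B = B'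

/-- A partition `λ` with at most `n` parts, each of size at most `n+1`
(the indexing set `Λ` for the Schubert classes of `Gr(n, 2n+1)`). -/
structure PartitionIn (n : ℕ) where
  part : ℕ → ℕ
  antitone : Antitone part
  head_le : part 0 ≤ n + 1
  vanish : ∀ i, n ≤ i → part i = 0

/-- The weight `|λ|` of a partition. -/
def wt (n : ℕ) (lam : PartitionIn n) : ℕ := ∑ i ∈ Finset.range n, lam.part i

/-- The Young diagram of a partition `λ ∈ Λ`. -/
def partDiag (n : ℕ) (lam : PartitionIn n) : Finset Cell :=
  (Finset.range n ×ˢ Finset.range (n+1)).filter fun c => c.2 < lam.part c.1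

/-- The `n × (n+1)` rectangular diagram `⊞`. -/
def rectDiag (n : ℕ) : Finset Cell := Finset.range n ×ˢ Finset.range (n+1)

/-- A standard Young tableau of rectangular shape `⊞`, with entries `1, …, n(n+1)`. -/
def IsSYTRect (n : ℕ) (T : Filling) : Prop :=
  IsTableauOn T (rectDiag n) (Finset.Icc 1 (n*(n+1)))

/-- A strict partition with all parts distinct, of size at most `n`, and at most
`n` parts (the indexing set `Σ` for Schubert classes of `OG(n, 2n+1)`). -/
structure StrictPartitionIn (n : ℕ) where
  part : ℕ → ℕ
  le_n : ∀ i, part i ≤ n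
  strict : ∀ i, part i = 0 ∨ part (i+1) < part i

/-- The weight `|σ|` of a strict partition. -/
def swt (n : ℕ) (s : StrictPartitionIn n) : ℕ := ∑ i ∈ Finset.range n, s.part i

/-- The shifted diagram of a strict partition: row `i` has `σ i` boxes starting
at column `i`. -/
def shiftedDiag (n : ℕ) (s : StrictPartitionIn n) : Finset Cell :=
  (Finset.range n ×ˢ Finset.range (2*n)).filter fun c => c.1 ≤ c.2 ∧ c.2 < c.1 + s.part c.1

/-- The staircase strict partition `δ = (n > n-1 > … > 1)`. -/
def staircase (n : ℕ) : StrictPartitionIn n where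
  part i := n - i
  le_n i := Nat.sub_le n i
  strict i := by
    show n - i = 0 ∨ n - (i+1) < n - i
    omega

/-- A standard shifted tableau of staircase shape `δ`, with entries `1, …, n(n+1)/2`. -/
def IsSSTstaircase (n : ℕ) (T : Filling) : Prop :=
  IsTableauOn T (shiftedDiag n (staircase n)) (Finset.Icc 1 (n*(n+1)/2))

/-- The partition `σ̃` associated to a strict partition `σ`:
`σ̃ⁱ = σⁱ + #{j : j ≤ i < j + σʲ}` (0-indexed). -/
def tildeFun {n : ℕ} (s : StrictPartitionIn n) (i : ℕ) : ℕ :=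
  s.part i + ((Finset.range n).filter fun j => j ≤ i ∧ i < j + s.part j).card

/-- Doubling a shifted (skew) tableau `T` to a symmetrical tableau `T⋆`: an entry `k` at
shifted cell `(i,j)` produces the even entry `2k` at `(i, j+1)` and the odd entry
`2k-1` at the transposed cell `(j, i)`. -/
def doubleFill (T : Filling) : Filling :=
  T.image (fun p => ((p.1.1, p.1.2 + 1), 2 * p.2)) ∪
  T.image (fun p => ((p.1.2, p.1.1), 2 * p.2 - 1))

/-- Deleting the odd entries of a tableau, dividing the remaining entries by `2` and
shifting each remaining cell one column to the left. -/
def halveFill (T : Filling) : Filling :=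
  (T.filter fun p => 2 ∣ p.2).image fun p => ((p.1.1, p.1.2 - 1), p.2 / 2)

/-- A rectangular standard tableau is symmetrical if whenever `2k-1` occupies cell
`(i,j)`, the entry `2k` occupies cell `(j, i+1)` (0-indexed version of
`i₂ₖ = j₂ₖ₋₁`, `j₂ₖ = i₂ₖ₋₁ + 1`). -/
def IsSymmetrical (T : Filling) : Prop :=
  ∀ i j k : ℕ, 1 ≤ k → ((i, j), 2*k - 1) ∈ T → ((j, i + 1), 2*k) ∈ T

/-- The subtableau `T_{[i,j]}` of entries lying in the interval `[i, j]`. -/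
def subTab (T : Filling) (i j : ℕ) : Filling := T.filter fun p => i ≤ p.2 ∧ p.2 ≤ j

/-- The subtableau `T_{<i}`. -/
def lowTab (T : Filling) (i : ℕ) : Filling := T.filter fun p => p.2 < i

/-- The subtableau `T_{>j}`. -/
def highTab (T : Filling) (j : ℕ) : Filling := T.filter fun p => j < p.2

/-! ### The Grassmannian, the Wronski map and the orthogonal Grassmannian -/

/-- The Wronskian of an `n`-tuple of polynomials. -/
noncomputable def wronskian (n : ℕ) (f : Fin n → ℂ[X]) : ℂ[X] :=
  (Matrix.of fun i j : Fin n => (fun p : ℂ[X] => derivative p)^[(i : ℕ)] (f j)).det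

/-- `x` is a point of `X = Gr(n, C_{2n}[z])`: an `n`-dimensional subspace of the
space of polynomials of degree at most `2n`. -/
def IsGrassPt (n : ℕ) (x : Submodule ℂ ℂ[X]) : Prop :=
  x ≤ degreeLT ℂ (2*n+1) ∧ Module.finrank ℂ x = n

/-- `Wr(x; z) = h(z)` up to a nonzero scalar: some (hence any) basis of `x` has
Wronskian a nonzero scalar multiple of `h`. -/
def WrEq (n : ℕ) (x : Submodule ℂ ℂ[X]) (h : ℂ[X]) : Prop :=
  ∃ f : Fin n → ℂ[X], Submodule.span ℂ (Set.range f) = x ∧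
    ∃ c : ℂ, c ≠ 0 ∧ wronskian n f = c • h

/-- The symmetric bilinear form
`⟨Σ aₖ zᵏ/k!, Σ bₗ zˡ/l!⟩ = Σ_{m} (-1)ᵐ aₘ b_{2n-m}` on `C_{2n}[z]`. -/
noncomputable def form (n : ℕ) (p q : ℂ[X]) : ℂ :=
  ∑ m ∈ Finset.range (2*n+1),
    (-1 : ℂ)^m * (Nat.factorial m : ℂ) * (Nat.factorial (2*n-m) : ℂ) *
      p.coeff m * q.coeff (2*n-m)

/-- `y` is a point of the orthogonal Grassmannian `Y = OG(n, C_{2n}[z])`: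
an `n`-dimensional isotropic subspace. -/
def IsOGPt (n : ℕ) (y : Submodule ℂ ℂ[X]) : Prop :=
  IsGrassPt n y ∧ ∀ p ∈ y, ∀ q ∈ y, form n p q = 0

/-- The flag `F_•(a)`, for `a ∈ ℂ ∪ {∞}` (with `none` playing the role of `∞`):
`F_i(a)` is the space of polynomials of degree at most `2n` divisible by
`(z+a)^{2n+1-i}`, and `F_i(∞) = C_{i-1}[z]`. -/
noncomputable def flag (n : ℕ) (a : Option ℂ) (i : ℕ) : Submodule ℂ ℂ[X] :=
  match a with
  | Option.none => degreeLT ℂ i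
  | Option.some a0 =>
    { carrier := {p : ℂ[X] | p ∈ degreeLT ℂ (2*n+1) ∧ (X + C a0)^(2*n+1-i) ∣ p}
      add_mem' := fun hp hq => ⟨add_mem hp.1 hq.1, dvd_add hp.2 hq.2⟩
      zero_mem' := ⟨zero_mem _, dvd_zero _⟩
      smul_mem' := by
        rintro c p ⟨h1, h2⟩
        refine ⟨Submodule.smul_mem _ _ h1, ?_⟩
        rw [Polynomial.smul_eq_C_mul]
        exact h2.mul_left _ }

/-- The Schubert variety `X_λ(a) ⊆ X` relative to the flag `F_•(a)`. -/
def SchubertX (n : ℕ) (lam : PartitionIn n) (a : Option ℂ) : Set (Submodule ℂ ℂ[X]) :=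
  {x | IsGrassPt n x ∧
    ∀ i < n, i + 1 ≤ Module.finrank ℂ ↥(x ⊓ flag n a (n + 2 + i - lam.part i))}

/-- The Schubert variety `Y_σ(a) = Y ∩ X_{σ̃}(a) ⊆ Y`. -/
def SchubertY (n : ℕ) (s : StrictPartitionIn n) (a : Option ℂ) : Set (Submodule ℂ ℂ[X]) :=
  {y | IsOGPt n y ∧
    ∀ i < n, i + 1 ≤ Module.finrank ℂ ↥(y ⊓ flag n a (n + 2 + i - tildeFun s i))}

/-! ### `ℝP¹`, fibres of the Wronski map, zones and the correspondence -/

/-- The inclusion `ℝP¹ = ℝ ∪ {∞} ↪ ℂ ∪ {∞}`. -/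
def toC (t : OnePoint ℝ) : Option ℂ := Option.map (fun r : ℝ => (r : ℂ)) t

/-- The linear factor `z + a` associated to `a ∈ ℝP¹` (equal to `1` for `a = ∞`). -/
noncomputable def linFactor (t : OnePoint ℝ) : ℂ[X] :=
  (toC t).elim 1 fun a0 => X + C a0

/-- The polynomial `∏_{aᵢ ≠ ∞} (z + aᵢ)` associated to a multiset `a` of points
of `ℝP¹`. -/
noncomputable def fibrePoly (a : Multiset (OnePoint ℝ)) : ℂ[X] := (a.map linFactor).prod

/-- The fibre `X(a)` of the Wronski map over `∏_{aᵢ ≠ ∞} (z + aᵢ)`. -/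
def fibre (n : ℕ) (a : Multiset (OnePoint ℝ)) : Set (Submodule ℂ ℂ[X]) :=
  {x | IsGrassPt n x ∧ WrEq n x (fibrePoly a)}

/-- The total order `⪯` on `ℝP¹` refining `|a| ≤ |b|`:
`a ⪯ b` iff `a = b`, `|a| < |b|`, or `0 < a = -b < ∞`. -/
def ple (x y : OnePoint ℝ) : Prop :=
  x = y ∨ (y = (∞ : OnePoint ℝ) ∧ x ≠ (∞ : OnePoint ℝ)) ∨
    ∃ r s : ℝ, x = (r : OnePoint ℝ) ∧ y = (s : OnePoint ℝ) ∧
      (|r| < |s| ∨ (0 < r ∧ r = -s))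

/-- The multiset `{v 1, …, v N}`. -/
def msOfN (N : ℕ) (v : ℕ → OnePoint ℝ) : Multiset (OnePoint ℝ) :=
  (Finset.Icc 1 N).val.map v

/-- `v 1 ⪯ v 2 ⪯ … ⪯ v N`. -/
def SortedOn (N : ℕ) (v : ℕ → OnePoint ℝ) : Prop :=
  ∀ k l, 1 ≤ k → k ≤ l → l ≤ N → ple (v k) (v l)

/-- The `⪯`-zone of `A` determined by a choice of signs `ε`. -/
def zoneN (N : ℕ) (eps : ℕ → Bool) : Set (ℕ → OnePoint ℝ) :=
  {v | SortedOn N v ∧ ∀ k, 1 ≤ k → k ≤ N →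
    (v k = (∞ : OnePoint ℝ) ∨
      ∃ r : ℝ, v k = (r : OnePoint ℝ) ∧ (if eps k then 0 ≤ r else r ≤ 0))}

/-- The doubled multiset `b⋆ = {b₁, b₁, …, b_M, b_M}`. -/
def starMs (M : ℕ) (v : ℕ → OnePoint ℝ) : Multiset (OnePoint ℝ) :=
  msOfN M v + msOfN M v

/-- The polynomial with coefficient vector `v`. -/
noncomputable def polyOfVec {m : ℕ} (v : Fin m → ℂ) : ℂ[X] :=
  ∑ i, C (v i) * X ^ (i : ℕ)

/-- The topology of the Grassmannian `Gr(n, C_{2n}[z])`: the quotient (coinduced)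
topology along the map sending a linearly independent `n`-tuple of coefficient
vectors to its span. -/
noncomputable def grassTop (n : ℕ) : TopologicalSpace (Submodule ℂ ℂ[X]) :=
  TopologicalSpace.coinduced
    (fun M : {M : Fin n → Fin (2*n+1) → ℂ // LinearIndependent ℂ M} =>
      Submodule.span ℂ (Set.range fun i => polyOfVec (M.1 i)))
    inferInstance

/-- The tangent space at `x` to the Schubert variety `X_λ(a)` (at a point of the
open cell), viewed inside `Hom(x, ℂ[z]/x)`: the maps `φ` with
`φ(x ∩ F_j(a)) ⊆ (F_j(a) + x)/x` for all `j`. -/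
def tangentSchubertSet (n : ℕ) (a : Option ℂ) (x : Submodule ℂ ℂ[X]) :
    Set (↥x →ₗ[ℂ] (ℂ[X] ⧸ x)) :=
  {φ | ∀ j ≤ 2*n+1, ∀ v : x, (v : ℂ[X]) ∈ flag n a j →
      φ v ∈ (flag n a j ⊔ x).map x.mkQ}

/-- The tangent space at an isotropic `x` to the orthogonal Grassmannian `Y`,
inside `Hom(x, ℂ[z]/x)`: the maps `φ` with `⟨φ v, w⟩ + ⟨v, φ w⟩ = 0`. -/
def tangentYSet (n : ℕ) (x : Submodule ℂ ℂ[X]) : Set (↥x →ₗ[ℂ] (ℂ[X] ⧸ x)) :=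
  {φ | ∀ v w : x, ∀ pv pw : ℂ[X],
      x.mkQ pv = φ v → x.mkQ pw = φ w →
      form n pv (w : ℂ[X]) + form n (v : ℂ[X]) pw = 0}

/-- Divisibility of `h` by `(z+a)^k`, where for `a = ∞` this means
`deg h ≤ n(n+1) - k`. -/
def rootMultCond (n : ℕ) (a : Option ℂ) (k : ℕ) (h : ℂ[X]) : Prop :=
  match a with
  | Option.some a0 => (X + C a0)^k ∣ h
  | Option.none => h.natDegree + k ≤ n*(n+1)

/-- The characterizing properties (i)-(v) of the correspondence
`(T, a) ↦ x_T(a)` of Theorem 2.3: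
(i) `x_T(a)` lies in the fibre `X(a)`;
(ii) `T ↦ x_T(a)` is surjective onto `X(a)`, and injective when `a` is a set;
(iii) `a ↦ x_T(a)` is continuous on every `⪯`-zone;
(iv) if `a_i = … = a_j` in the `⪯`-sorted order then `x_T(a) ∈ X_λ(a_i)` where `λ`
is the rectification shape of `T_{[i,j]}`;
(v) under the hypotheses of (iv), if `T_{<i} = T'_{<i}` and `T_{>j} = T'_{>j}` then
`x_T(a) = x_{T'}(a)` iff `T_{[i,j]}` and `T'_{[i,j]}` are dual equivalent. -/
structure CorrProps (n : ℕ)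
    (xmap : Filling → Multiset (OnePoint ℝ) → Submodule ℂ ℂ[X]) : Prop where
  mem_fibre : ∀ T a, IsSYTRect n T → Multiset.card a = n*(n+1) →
    xmap T a ∈ fibre n a
  surj : ∀ a, Multiset.card a = n*(n+1) → ∀ x ∈ fibre n a,
    ∃ T, IsSYTRect n T ∧ xmap T a = x
  inj : ∀ a, Multiset.card a = n*(n+1) → Multiset.Nodup a →
    ∀ T T', IsSYTRect n T → IsSYTRect n T' → xmap T a = xmap T' a → T = T'
  contOn : ∀ T, IsSYTRect n T → ∀ eps : ℕ → Bool,
    @ContinuousOn (ℕ → OnePoint ℝ) (Submodule ℂ ℂ[X]) _ (grassTop n)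
      (fun v => xmap T (msOfN (n*(n+1)) v)) (zoneN (n*(n+1)) eps)
  schub : ∀ v : ℕ → OnePoint ℝ, SortedOn (n*(n+1)) v →
    ∀ i j, 1 ≤ i → i ≤ j → j ≤ n*(n+1) → (∀ k, i ≤ k → k ≤ j → v k = v i) →
    ∀ T, IsSYTRect n T →
    ∀ lam : PartitionIn n, ∀ R : Filling,
      RectifiesTo (subTab T i j) (cellsOf (lowTab T i)) R →
      cellsOf R = partDiag n lam →
      xmap T (msOfN (n*(n+1)) v) ∈ SchubertX n lam (toC (v i))
  dual : ∀ v : ℕ → OnePoint ℝ, SortedOn (n*(n+1)) v →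
    ∀ i j, 1 ≤ i → i ≤ j → j ≤ n*(n+1) → (∀ k, i ≤ k → k ≤ j → v k = v i) →
    ∀ T T', IsSYTRect n T → IsSYTRect n T' →
      lowTab T i = lowTab T' i → highTab T j = highTab T' j →
      (xmap T (msOfN (n*(n+1)) v) = xmap T' (msOfN (n*(n+1)) v) ↔
        DualEquiv (cellsOf (lowTab T i)) (subTab T i j) (subTab T' i j))


/-- The alternating sum `Σ (-1)ᵐ p⁽ᵐ⁾ q⁽ᴺ⁻ᵐ⁾`. -/
noncomputable def altSum (N : ℕ) (p q : ℂ[X]) : ℂ[X] :=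
  ∑ m ∈ Finset.range (N+1), (-1 : ℂ[X])^m * (derivative^[m] p * derivative^[N-m] q)

theorem iterate_zero_of_mem {N : ℕ} {p : ℂ[X]} (hp : p ∈ degreeLT ℂ (N+1)) :
    derivative^[N+1] p = 0 := by
  apply Polynomial.iterate_derivative_eq_zero_of_degree_lt
  exact_mod_cast Polynomial.mem_degreeLT.1 hp

theorem derivative_altSum (N : ℕ) (p q : ℂ[X]) (hp : p ∈ degreeLT ℂ (N+1))
    (hq : q ∈ degreeLT ℂ (N+1)) : derivative (altSum N p q) = 0 := by
  have h : derivative (altSum N p q) = ∑ m ∈ Finset.range (N+1),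
      ((-1 : ℂ[X])^m * (derivative^[m] p * derivative^[N+1-m] q) -
        (-1 : ℂ[X])^(m+1) * (derivative^[m+1] p * derivative^[N+1-(m+1)] q)) := by
    unfold altSum
    rw [Polynomial.derivative_sum]
    refine Finset.sum_congr rfl fun m hm => ?_
    have hm' : m ≤ N := by simpa [Nat.lt_succ_iff] using hm
    have e1 : N + 1 - m = (N - m) + 1 := by omega
    have e2 : N + 1 - (m + 1) = N - m := by omega
    have e3 : derivative ((-1 : ℂ[X])^m) = 0 := by
      have : ((-1 : ℂ[X])^m) = C ((-1 : ℂ)^m) := by simp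
      rw [this, derivative_C]
    rw [e1, e2, derivative_mul, e3, derivative_mul, Function.iterate_succ_apply',
      Function.iterate_succ_apply']
    ring
  rw [h, Finset.sum_range_sub']
  simp only [Nat.sub_zero, iterate_zero_of_mem hp, iterate_zero_of_mem hq]
  simp

theorem eval_zero_iterate (k : ℕ) (p : ℂ[X]) :
    (derivative^[k] p).eval 0 = (Nat.factorial k : ℂ) * p.coeff k := by
  rw [← Polynomial.coeff_zero_eq_eval_zero, Polynomial.coeff_iterate_derivative]
  simp [Nat.descFactorial_self]

theorem form_eq_eval (n : ℕ) (p q : ℂ[X]) : form n p q = (altSum (2*n) p q).eval 0 := by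
  unfold form altSum
  rw [Polynomial.eval_finset_sum]
  refine Finset.sum_congr rfl fun m _ => ?_
  rw [eval_mul, eval_mul, eval_zero_iterate, eval_zero_iterate]
  simp
  ring

theorem eval_iterate_of_dvd {a : ℂ} {k m : ℕ} {p : ℂ[X]} (h : (X + C a)^k ∣ p) (hm : m < k) :
    (derivative^[m] p).eval (-a) = 0 := by
  have h1 := Polynomial.pow_sub_dvd_iterate_derivative_of_pow_dvd m h
  have h2 : (X + C a) ∣ derivative^[m] p := (dvd_pow_self _ (by omega)).trans h1
  obtain ⟨r, hr⟩ := h2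
  rw [hr]
  simp

/-- For every `a ∈ ℂ ∪ {∞}` and `0 ≤ i ≤ 2n+1`, the flag `F_•(a)` satisfies
`⟨F_i(a), F_{2n+1-i}(a)⟩ = {0}`. -/
theorem flag_isotropic (n : ℕ) (a : Option ℂ) (i : ℕ) (hi : i ≤ 2*n+1) :
    ∀ p ∈ flag n a i, ∀ q ∈ flag n a (2*n+1-i), form n p q = 0 := by
  intro p hp q hq
  cases a with
  | none =>
    replace hp : p ∈ degreeLT ℂ i := hp
    replace hq : q ∈ degreeLT ℂ (2*n+1-i) := hq
    rw [Polynomial.mem_degreeLT] at hp hq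
    refine Finset.sum_eq_zero fun m hm => ?_
    have hm' := Finset.mem_range.1 hm
    by_cases h : i ≤ m
    · rw [Polynomial.coeff_eq_zero_of_degree_lt (hp.trans_le (by exact_mod_cast h))]
      simp
    · have h' : 2*n+1-i ≤ 2*n-m := by omega
      rw [Polynomial.coeff_eq_zero_of_degree_lt (hq.trans_le (by exact_mod_cast h'))]
      simp
  | some a0 =>
    obtain ⟨hp1, hp2⟩ : p ∈ degreeLT ℂ (2*n+1) ∧ (X + C a0)^(2*n+1-i) ∣ p := hp
    obtain ⟨hq1, hq2⟩ : q ∈ degreeLT ℂ (2*n+1) ∧ (X + C a0)^(2*n+1-(2*n+1-i)) ∣ q := hq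
    have hd := derivative_altSum (2*n) p q hp1 hq1
    have hc := Polynomial.eq_C_of_derivative_eq_zero hd
    have he : (altSum (2*n) p q).eval 0 = (altSum (2*n) p q).eval (-a0) := by
      rw [hc]; simp
    rw [form_eq_eval, he, altSum, Polynomial.eval_finset_sum]
    refine Finset.sum_eq_zero fun m hm => ?_
    have hm' := Finset.mem_range.1 hm
    rw [eval_mul, eval_mul]
    by_cases h : m < 2*n+1-i
    · rw [eval_iterate_of_dvd hp2 h]; simp
    · rw [eval_iterate_of_dvd (m := 2*n-m) hq2 (by omega)]; simp

end OG
end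

section
/- Deleting the odd entries from a symmetrical tableau T ∈ SYT(⊞) and dividing the remaining entries by 2 yields a standard shifted tableau of staircase shape δ = (n > n−1 > … > 1), and this map T ↦ T restricted to even entries is a bijection from the set of symmetrical tableaux in SYT(⊞) onto SST(δ). -/
open Polynomial OnePoint

namespace OG

/-- Unfolded description of a tableau on a diagram. -/
lemma isTableauOn_iff (f : Filling) (D : Finset Cell) (E : Finset ℕ) :
    IsTableauOn f D E ↔
      (∀ i j e e', ((i, j), e) ∈ f → ((i, j), e') ∈ f → e = e') ∧
      (∀ i j i' j' e, ((i, j), e) ∈ f → ((i', j'), e) ∈ f → i = i' ∧ j = j') ∧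
      (∀ i j j' e e', ((i, j), e) ∈ f → ((i, j'), e') ∈ f → j < j' → e < e') ∧
      (∀ i i' j e e', ((i, j), e) ∈ f → ((i', j), e') ∈ f → i < i' → e < e') ∧
      (∀ i j, (i, j) ∈ D → ∃ e, ((i, j), e) ∈ f) ∧
      (∀ i j e, ((i, j), e) ∈ f → (i, j) ∈ D) ∧
      (∀ e, e ∈ E → ∃ i j, ((i, j), e) ∈ f) ∧
      (∀ i j e, ((i, j), e) ∈ f → e ∈ E) := by
  constructor
  · rintro ⟨⟨h1, h2, h3, h4⟩, rfl, rfl⟩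
    refine ⟨?_, ?_, ?_, ?_, ?_, ?_, ?_, ?_⟩
    · intro i j e e' h h'
      have := h1 _ h _ h' rfl
      simpa using this
    · intro i j i' j' e h h'
      have := h2 _ h _ h' rfl
      simpa using this
    · intro i j j' e e' h h' hj
      exact h3 _ h _ h' rfl hj
    · intro i i' j e e' h h' hj
      exact h4 _ h _ h' rfl hj
    · intro i j h
      simpa [cellsOf] using h
    · intro i j e h
      exact Finset.mem_image.2 ⟨_, h, rfl⟩
    · intro e h
      simpa [entriesOf] using h
    · intro i j e h
      exact Finset.mem_image.2 ⟨_, h, rfl⟩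
  · rintro ⟨h1, h2, h3, h4, h5, h6, h7, h8⟩
    refine ⟨⟨?_, ?_, ?_, ?_⟩, ?_, ?_⟩
    · rintro ⟨⟨i, j⟩, e⟩ h ⟨⟨i', j'⟩, e'⟩ h' heq
      simp only [Prod.mk.injEq] at heq
      obtain ⟨rfl, rfl⟩ := heq
      rw [h1 _ _ _ _ h h']
    · rintro ⟨⟨i, j⟩, e⟩ h ⟨⟨i', j'⟩, e'⟩ h' heq
      simp only at heq
      subst heq
      obtain ⟨rfl, rfl⟩ := h2 _ _ _ _ _ h h'
      rfl
    · rintro ⟨⟨i, j⟩, e⟩ h ⟨⟨i', j'⟩, e'⟩ h' heq hlt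
      simp only at heq hlt
      subst heq
      exact h3 _ _ _ _ _ h h' hlt
    · rintro ⟨⟨i, j⟩, e⟩ h ⟨⟨i', j'⟩, e'⟩ h' heq hlt
      simp only at heq hlt
      subst heq
      exact h4 _ _ _ _ _ h h' hlt
    · ext ⟨i, j⟩
      constructor
      · intro h
        obtain ⟨⟨c, e⟩, h, rfl⟩ := Finset.mem_image.1 h
        exact h6 _ _ _ h
      · intro h
        obtain ⟨e, h⟩ := h5 _ _ h
        exact Finset.mem_image.2 ⟨_, h, rfl⟩
    · ext e
      constructor
      · intro h
        obtain ⟨⟨⟨i, j⟩, e⟩, hm, rfl⟩ := Finset.mem_image.1 h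
        exact h8 _ _ _ hm
      · intro h
        obtain ⟨i, j, h⟩ := h7 _ h
        exact Finset.mem_image.2 ⟨_, h, rfl⟩

lemma mem_rect (n i j : ℕ) : (i, j) ∈ rectDiag n ↔ i < n ∧ j < n + 1 := by
  simp [rectDiag]

lemma mem_stair (n i j : ℕ) : (i, j) ∈ shiftedDiag n (staircase n) ↔ i ≤ j ∧ j < n := by
  rw [shiftedDiag, Finset.mem_filter, Finset.mem_product, Finset.mem_range, Finset.mem_range]
  change (i < n ∧ j < 2 * n) ∧ i ≤ j ∧ j < i + (n - i) ↔ _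
  omega

lemma half_double (n : ℕ) : 2 * (n * (n + 1) / 2) = n * (n + 1) :=
  Nat.mul_div_cancel' (Nat.even_mul_succ_self n).two_dvd

lemma mem_double (S : Filling) (i j e : ℕ) : ((i, j), e) ∈ doubleFill S ↔
    (∃ j0 k, ((i, j0), k) ∈ S ∧ j = j0 + 1 ∧ e = 2 * k) ∨
    (∃ k, ((j, i), k) ∈ S ∧ e = 2 * k - 1) := by
  simp only [doubleFill, Finset.mem_union, Finset.mem_image, Prod.mk.injEq, Prod.exists]
  constructor
  · rintro (⟨a, b, k, h, ⟨rfl, rfl⟩, rfl⟩ | ⟨a, b, k, h, ⟨rfl, rfl⟩, rfl⟩)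
    · exact Or.inl ⟨_, _, h, rfl, rfl⟩
    · exact Or.inr ⟨_, h, rfl⟩
  · rintro (⟨j0, k, h, rfl, rfl⟩ | ⟨k, h, rfl⟩)
    · exact Or.inl ⟨_, _, _, h, ⟨rfl, rfl⟩, rfl⟩
    · exact Or.inr ⟨_, _, _, h, ⟨rfl, rfl⟩, rfl⟩

lemma mem_halve (T : Filling) (i j e : ℕ) : ((i, j), e) ∈ halveFill T ↔
    ∃ j0, ((i, j0), 2 * e) ∈ T ∧ j = j0 - 1 := by
  simp only [halveFill, Finset.mem_image, Finset.mem_filter, Prod.mk.injEq, Prod.exists]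
  constructor
  · rintro ⟨a, b, k, ⟨h, m, rfl⟩, ⟨rfl, rfl⟩, rfl⟩
    refine ⟨b, ?_, rfl⟩
    simpa using h
  · rintro ⟨j0, h, rfl⟩
    exact ⟨_, _, _, ⟨h, Dvd.intro _ rfl⟩, ⟨rfl, rfl⟩, by omega⟩

/-- Structure of symmetrical tableaux: odd entries lie weakly below the diagonal. -/
lemma sym_odd_low (n : ℕ) (T : Filling) (hT : IsSYTRect n T) (hs : IsSymmetrical T) :
    ∀ k i j, 1 ≤ k → ((i, j), 2 * k - 1) ∈ T → j ≤ i := by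
  obtain ⟨h1, h2, h3, h4, h5, h6, h7, h8⟩ := (isTableauOn_iff _ _ _).1 hT
  intro k
  induction k using Nat.strong_induction_on with
  | _ k ih =>
  intro i j hk h
  by_contra hij
  push Not at hij
  obtain ⟨b, rfl⟩ : ∃ b, j = b + 1 := ⟨j - 1, by omega⟩
  have hev := hs _ _ _ hk h
  have r1 := (mem_rect _ _ _).1 (h6 _ _ _ hev)
  obtain ⟨e, he⟩ := h5 b i ((mem_rect _ _ _).2 (by omega))
  obtain ⟨e', he'⟩ := h5 (b + 1) i ((mem_rect _ _ _).2 (by omega))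
  have l1 := h4 _ _ _ _ _ he he' (by omega)
  have l2 := h3 _ _ _ _ _ he' hev (by omega)
  have hE := h8 _ _ _ he
  have hE2 := h8 _ _ _ hev
  rw [Finset.mem_Icc] at hE hE2
  rcases Nat.even_or_odd' e with ⟨m, rfl | rfl⟩
  · obtain ⟨a, c, hm⟩ := h7 (2 * m - 1) (Finset.mem_Icc.2 (by omega))
    have := hs _ _ _ (by omega) hm
    obtain ⟨q1, q2⟩ := h2 _ _ _ _ _ this he
    have := ih m (by omega) _ _ (by omega) hm
    omega
  · have := hs b i (m + 1) (by omega) he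
    have := h1 _ _ _ _ this h
    omega

lemma sym_iff (n : ℕ) (T : Filling) (hT : IsSYTRect n T) (hs : IsSymmetrical T) (k i j : ℕ)
    (hk : 1 ≤ k) : ((i, j), 2 * k - 1) ∈ T ↔ ((j, i + 1), 2 * k) ∈ T := by
  obtain ⟨h1, h2, h3, h4, h5, h6, h7, h8⟩ := (isTableauOn_iff _ _ _).1 hT
  refine ⟨hs _ _ _ hk, fun h => ?_⟩
  have hE := h8 _ _ _ h
  rw [Finset.mem_Icc] at hE
  obtain ⟨a, c, hm⟩ := h7 (2 * k - 1) (Finset.mem_Icc.2 (by omega))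
  obtain ⟨q1, q2⟩ := h2 _ _ _ _ _ (hs _ _ _ hk hm) h
  obtain rfl : a = i := by omega
  subst q1
  exact hm

/-- Even entries lie strictly above the diagonal. -/
lemma sym_even_up (n : ℕ) (T : Filling) (hT : IsSYTRect n T) (hs : IsSymmetrical T) (k i j : ℕ)
    (h : ((i, j), 2 * k) ∈ T) : i < j ∧ 1 ≤ k := by
  obtain ⟨h1, h2, h3, h4, h5, h6, h7, h8⟩ := (isTableauOn_iff _ _ _).1 hT
  have hE := h8 _ _ _ h
  rw [Finset.mem_Icc] at hE
  obtain ⟨a, c, hm⟩ := h7 (2 * k - 1) (Finset.mem_Icc.2 (by omega))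
  obtain ⟨q1, q2⟩ := h2 _ _ _ _ _ (hs _ _ _ (by omega) hm) h
  have := sym_odd_low n T hT hs k a c (by omega) hm
  omega

lemma mem_halve_sym (n : ℕ) (T : Filling) (hT : IsSYTRect n T) (hs : IsSymmetrical T)
    (i j e : ℕ) : ((i, j), e) ∈ halveFill T ↔ ((i, j + 1), 2 * e) ∈ T := by
  rw [mem_halve]
  constructor
  · rintro ⟨j0, h, rfl⟩
    have := sym_even_up n T hT hs _ _ _ h
    rwa [Nat.sub_add_cancel (by omega)]
  · intro h
    exact ⟨_, h, by omega⟩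

lemma halve_mapsTo (n : ℕ) (T : Filling) (hT : IsSYTRect n T) (hs : IsSymmetrical T) :
    IsSSTstaircase n (halveFill T) := by
  obtain ⟨h1, h2, h3, h4, h5, h6, h7, h8⟩ := (isTableauOn_iff _ _ _).1 hT
  have hd := half_double n
  refine (isTableauOn_iff _ _ _).2 ⟨?_, ?_, ?_, ?_, ?_, ?_, ?_, ?_⟩
  all_goals simp only [mem_halve_sym n T hT hs, mem_stair, Finset.mem_Icc]
  · intro i j e e' h h'
    have := h1 _ _ _ _ h h'
    omega
  · intro i j i' j' e h h'
    have := h2 _ _ _ _ _ h h'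
    omega
  · intro i j j' e e' h h' hj
    have := h3 _ _ _ _ _ h h' (by omega)
    omega
  · intro i i' j e e' h h' hj
    have := h4 _ _ _ _ _ h h' (by omega)
    omega
  · intro i j hij
    obtain ⟨e, he⟩ := h5 i (j + 1) ((mem_rect _ _ _).2 (by omega))
    rcases Nat.even_or_odd' e with ⟨m, rfl | rfl⟩
    · exact ⟨m, he⟩
    · have := sym_odd_low n T hT hs (m + 1) _ _ (by omega) he
      omega
  · intro i j e h
    have r := (mem_rect _ _ _).1 (h6 _ _ _ h)
    have := sym_even_up n T hT hs _ _ _ h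
    omega
  · intro e he
    obtain ⟨i, j, h⟩ := h7 (2 * e) (Finset.mem_Icc.2 (by omega))
    have := sym_even_up n T hT hs _ _ _ h
    exact ⟨i, j - 1, by rwa [Nat.sub_add_cancel (by omega)]⟩
  · intro i j e h
    have := Finset.mem_Icc.1 (h8 _ _ _ h)
    omega

lemma sym_mem_iff (n : ℕ) (T : Filling) (hT : IsSYTRect n T) (hs : IsSymmetrical T) :
    T = doubleFill (halveFill T) := by
  obtain ⟨h1, h2, h3, h4, h5, h6, h7, h8⟩ := (isTableauOn_iff _ _ _).1 hT
  ext ⟨⟨i, j⟩, e⟩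
  rw [mem_double]
  simp only [mem_halve_sym n T hT hs]
  constructor
  · intro h
    rcases Nat.even_or_odd' e with ⟨m, rfl | rfl⟩
    · have := sym_even_up n T hT hs _ _ _ h
      exact Or.inl ⟨j - 1, m, by rwa [Nat.sub_add_cancel (by omega)], by omega, rfl⟩
    · exact Or.inr ⟨m + 1, hs _ _ (m + 1) (by omega) h, by omega⟩
  · rintro (⟨j0, k, h, rfl, rfl⟩ | ⟨k, h, rfl⟩)
    · exact h
    · exact (sym_iff n T hT hs k i j (sym_even_up n T hT hs _ _ _ h).2).2 h

lemma sst_mono (n : ℕ) (S : Filling) (hS : IsSSTstaircase n S) (a b c d k k' : ℕ)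
    (h : ((a, b), k) ∈ S) (h' : ((c, d), k') ∈ S) (hac : a ≤ c) (hbd : b ≤ d) :
    k ≤ k' ∧ (a + b < c + d → k < k') := by
  obtain ⟨h1, h2, h3, h4, h5, h6, h7, h8⟩ := (isTableauOn_iff _ _ _).1 hS
  have r := (mem_stair _ _ _).1 (h6 _ _ _ h)
  have r' := (mem_stair _ _ _).1 (h6 _ _ _ h')
  obtain ⟨m, hm⟩ := h5 a d ((mem_stair _ _ _).2 (by omega))
  have l1 : k ≤ m ∧ (b < d → k < m) := by
    rcases hbd.eq_or_lt with rfl | hlt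
    · have := h1 _ _ _ _ h hm
      omega
    · have := h3 _ _ _ _ _ h hm hlt
      omega
  have l2 : m ≤ k' ∧ (a < c → m < k') := by
    rcases hac.eq_or_lt with rfl | hlt
    · have := h1 _ _ _ _ h' hm
      omega
    · have := h4 _ _ _ _ _ hm h' hlt
      omega
  omega

lemma double_mapsTo (n : ℕ) (S : Filling) (hS : IsSSTstaircase n S) :
    IsSYTRect n (doubleFill S) := by
  obtain ⟨h1, h2, h3, h4, h5, h6, h7, h8⟩ := (isTableauOn_iff _ _ _).1 hS
  have hd := half_double n
  have mono := sst_mono n S hS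
  have hc : ∀ i j e, ((i, j), e) ∈ S → i ≤ j ∧ j < n ∧ 1 ≤ e ∧ e ≤ n * (n + 1) / 2 := by
    intro i j e h
    have r := (mem_stair _ _ _).1 (h6 _ _ _ h)
    have := Finset.mem_Icc.1 (h8 _ _ _ h)
    omega
  refine (isTableauOn_iff _ _ _).2 ⟨?_, ?_, ?_, ?_, ?_, ?_, ?_, ?_⟩
  all_goals simp only [mem_double, mem_rect, Finset.mem_Icc]
  · rintro i j e e' (⟨j0, k, h, rfl, rfl⟩ | ⟨k, h, rfl⟩) (⟨j1, k', h', hj, rfl⟩ | ⟨k', h', rfl⟩)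
    · obtain rfl : j0 = j1 := by omega
      rw [h1 _ _ _ _ h h']
    · have := hc _ _ _ h
      have := hc _ _ _ h'
      omega
    · have := hc _ _ _ h
      have := hc _ _ _ h'
      omega
    · rw [h1 _ _ _ _ h h']
  · rintro i j i' j' e (⟨j0, k, h, rfl, rfl⟩ | ⟨k, h, rfl⟩)
      (⟨j1, k', h', rfl, hk⟩ | ⟨k', h', hk⟩)
    · obtain rfl : k = k' := by omega
      have := h2 _ _ _ _ _ h h'
      omega
    · have := hc _ _ _ h
      have := hc _ _ _ h'
      omega
    · have := hc _ _ _ h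
      have := hc _ _ _ h'
      omega
    · have := hc _ _ _ h
      have := hc _ _ _ h'
      obtain rfl : k = k' := by omega
      have := h2 _ _ _ _ _ h h'
      omega
  · rintro i j j' e e' (⟨j0, k, h, rfl, rfl⟩ | ⟨k, h, rfl⟩)
      (⟨j1, k', h', rfl, rfl⟩ | ⟨k', h', rfl⟩) hlt
    all_goals
      have c1 := hc _ _ _ h
      have c2 := hc _ _ _ h'
    · have := mono _ _ _ _ _ _ h h' (by omega) (by omega)
      omega
    · omega
    · have := mono _ _ _ _ _ _ h h' (by omega) (by omega)
      omega
    · have := mono _ _ _ _ _ _ h h' (by omega) (by omega)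
      omega
  · rintro i i' j e e' (⟨j0, k, h, rfl, rfl⟩ | ⟨k, h, rfl⟩)
      (⟨j1, k', h', hj, rfl⟩ | ⟨k', h', rfl⟩) hlt
    all_goals
      have c1 := hc _ _ _ h
      have c2 := hc _ _ _ h'
    · have := mono _ _ _ _ _ _ h h' (by omega) (by omega)
      omega
    · have := mono _ _ _ _ _ _ h h' (by omega) (by omega)
      omega
    · omega
    · have := mono _ _ _ _ _ _ h h' (by omega) (by omega)
      omega
  · intro i j hij
    by_cases hle : j ≤ i
    · obtain ⟨k, h⟩ := h5 j i ((mem_stair _ _ _).2 (by omega))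
      exact ⟨_, Or.inr ⟨k, h, rfl⟩⟩
    · obtain ⟨k, h⟩ := h5 i (j - 1) ((mem_stair _ _ _).2 (by omega))
      exact ⟨_, Or.inl ⟨_, k, h, by omega, rfl⟩⟩
  · rintro i j e (⟨j0, k, h, rfl, rfl⟩ | ⟨k, h, rfl⟩)
    all_goals
      have c1 := hc _ _ _ h
      omega
  · intro e he
    rcases Nat.even_or_odd' e with ⟨m, rfl | rfl⟩
    · obtain ⟨i, j, h⟩ := h7 m (Finset.mem_Icc.2 (by omega))
      exact ⟨i, j + 1, Or.inl ⟨j, m, h, rfl, rfl⟩⟩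
    · obtain ⟨i, j, h⟩ := h7 (m + 1) (Finset.mem_Icc.2 (by omega))
      exact ⟨j, i, Or.inr ⟨m + 1, h, by omega⟩⟩
  · rintro i j e (⟨j0, k, h, rfl, rfl⟩ | ⟨k, h, rfl⟩)
    all_goals
      have c1 := hc _ _ _ h
      omega

lemma double_sym (n : ℕ) (S : Filling) (hS : IsSSTstaircase n S) :
    IsSymmetrical (doubleFill S) := by
  obtain ⟨h1, h2, h3, h4, h5, h6, h7, h8⟩ := (isTableauOn_iff _ _ _).1 hS
  intro i j k hk h
  rw [mem_double] at h ⊢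
  rcases h with ⟨j0, k', h, rfl, hk'⟩ | ⟨k', h, hk'⟩
  · omega
  · have := Finset.mem_Icc.1 (h8 _ _ _ h)
    obtain rfl : k = k' := by omega
    exact Or.inl ⟨i, k, h, rfl, rfl⟩

lemma halve_double (n : ℕ) (S : Filling) (hS : IsSSTstaircase n S) :
    halveFill (doubleFill S) = S := by
  obtain ⟨h1, h2, h3, h4, h5, h6, h7, h8⟩ := (isTableauOn_iff _ _ _).1 hS
  ext ⟨⟨i, j⟩, e⟩
  rw [mem_halve_sym n _ (double_mapsTo n S hS) (double_sym n S hS), mem_double]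
  constructor
  · rintro (⟨j0, k, h, hj, hk⟩ | ⟨k, h, hk⟩)
    · obtain rfl : j = j0 := by omega
      obtain rfl : e = k := by omega
      exact h
    · have := Finset.mem_Icc.1 (h8 _ _ _ h)
      omega
  · intro h
    exact Or.inl ⟨j, e, h, rfl, rfl⟩

/-- Deleting the odd entries of a symmetrical tableau `T ∈ SYT(⊞)` and halving the
remaining entries yields a standard shifted tableau of staircase shape, and this
is a bijection from symmetrical tableaux in `SYT(⊞)` onto `SST(δ)`. -/
theorem symmetrical_bijects_with_shifted (n : ℕ) :
    Set.BijOn halveFill {T | IsSYTRect n T ∧ IsSymmetrical T}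
      {S | IsSSTstaircase n S} := by
  refine ⟨fun T hT => halve_mapsTo n T hT.1 hT.2, ?_, ?_⟩
  · intro T hT T' hT' heq
    rw [sym_mem_iff n T hT.1 hT.2, sym_mem_iff n T' hT'.1 hT'.2, heq]
  · intro S hS
    exact ⟨doubleFill S, ⟨double_mapsTo n S hS, double_sym n S hS⟩, halve_double n S hS⟩

end OG
end
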